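/- A non-complete finite simple graph G of order n with no isolated vertices satisfies gp(μ(G)) = n + α(G) − 1 if and only if G is isomorphic to (i) a clique K_{n−1} with a single pendant leaf attached, or (ii) a star, or else (iii) the vertex set of G can be partitioned into four sets V11, V12, V2 and {x} such that: V11 ∪ V12 is an independent set; each vertex of V11 is a leaf adjacent to x; x is adjacent to every vertex of V12; the set of edges between V12 and V2 is a matching of size at least 1 that saturates both V12 and V2; and if V11 ≠ ∅ then x is a universal vertex of G, whilst if V11 = ∅ then x is adjacent to every vertex w ∈ V2 that is not adjacent to every other vertex of V2. -/

import Mathlib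

open SimpleGraph

variable {V : Type*}

/-- The Mycielskian of a graph `G`: vertices are `some (Sum.inl v)` (original vertices),
`some (Sum.inr v)` (twin vertices), and `none` (the root `u*`). -/
def Mycielskian (G : SimpleGraph V) : SimpleGraph (Option (V ⊕ V)) :=
  SimpleGraph.fromRel (fun x y =>
    (∃ u v, G.Adj u v ∧ x = some (Sum.inl u) ∧ y = some (Sum.inl v)) ∨
    (∃ u v, G.Adj u v ∧ x = some (Sum.inl u) ∧ y = some (Sum.inr v)) ∨
    (∃ u, x = some (Sum.inr u) ∧ y = none))

/-- `S` is a general position set: no shortest path between two vertices of `S`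
contains a third element of `S`. -/
def IsGPSet (G : SimpleGraph V) (S : Set V) : Prop :=
  ∀ u ∈ S, ∀ v ∈ S, ∀ p : G.Walk u v, p.length = G.dist u v →
    ∀ w ∈ S, w ∈ p.support → w = u ∨ w = v

/-- The general position number of `G`: the maximum cardinality of a general position set. -/
noncomputable def gpNumber (G : SimpleGraph V) [Fintype V] : ℕ :=
  sSup {k | ∃ S : Set V, IsGPSet G S ∧ S.ncard = k}

/-- A gp-set: a general position set of maximum cardinality. -/
def IsGpSet (G : SimpleGraph V) [Fintype V] (S : Set V) : Prop :=
  IsGPSet G S ∧ S.ncard = gpNumber G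

/-- The independence number of `G`. -/
noncomputable def indepNumber (G : SimpleGraph V) [Fintype V] : ℕ :=
  sSup {k | ∃ S : Set V, (∀ u ∈ S, ∀ v ∈ S, ¬ G.Adj u v) ∧ S.ncard = k}

section Mycielskian

variable {G : SimpleGraph V} {u v w x : V}

@[simp] lemma mycielskian_adj_inl_inl :
    (Mycielskian G).Adj (some (Sum.inl u)) (some (Sum.inl v)) ↔ G.Adj u v := by
  simp only [Mycielskian, fromRel_adj]
  constructor
  · rintro ⟨-, h⟩
    have := G.adj_comm u v
    grind
  · exact fun h => ⟨by simpa using h.ne, Or.inl (Or.inl ⟨u, v, h, rfl, rfl⟩)⟩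

@[simp] lemma mycielskian_adj_inl_inr :
    (Mycielskian G).Adj (some (Sum.inl u)) (some (Sum.inr v)) ↔ G.Adj u v := by
  simp [Mycielskian]

@[simp] lemma mycielskian_adj_inr_inl :
    (Mycielskian G).Adj (some (Sum.inr u)) (some (Sum.inl v)) ↔ G.Adj u v := by
  rw [adj_comm, mycielskian_adj_inl_inr, adj_comm]

@[simp] lemma not_mycielskian_adj_inr_inr :
    ¬ (Mycielskian G).Adj (some (Sum.inr u)) (some (Sum.inr v)) := by
  simp [Mycielskian]

@[simp] lemma mycielskian_adj_inr_none :
    (Mycielskian G).Adj (some (Sum.inr u)) none := by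
  simp [Mycielskian]

@[simp] lemma mycielskian_adj_none_inr :
    (Mycielskian G).Adj none (some (Sum.inr u)) :=
  mycielskian_adj_inr_none.symm

@[simp] lemma not_mycielskian_adj_inl_none :
    ¬ (Mycielskian G).Adj (some (Sum.inl u)) none := by
  simp [Mycielskian]

@[simp] lemma not_mycielskian_adj_none_inl :
    ¬ (Mycielskian G).Adj none (some (Sum.inl u)) :=
  fun h => not_mycielskian_adj_inl_none h.symm

/-- Replacing the first vertex of a walk by its twin does not require a longer walk. -/
lemma exists_walk_from_twin {b a : V} (hab : a ≠ b)
    (p : (Mycielskian G).Walk (some (Sum.inl b)) (some (Sum.inl a))) :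
    ∃ q : (Mycielskian G).Walk (some (Sum.inr b)) (some (Sum.inl a)), q.length ≤ p.length := by
  cases p with
  | nil => exact absurd rfl hab
  | @cons _ y _ h p =>
    rcases y with _ | y | y
    · simp at h
    · exact ⟨.cons (by simpa using h) p, by simp⟩
    · cases p with
      | @cons _ z _ h' p =>
        rcases z with _ | z | z
        · exact ⟨.cons (by simp) p, by simp⟩
        · exact ⟨.cons (v := some (Sum.inl y)) (by simpa using h)
            (.cons (by simpa using h') p), by simp⟩
        · simp at h'

end Mycielskian

section GeneralPosition

variable {W : Type*} {H : SimpleGraph W} {S : Set W} {u v w : W}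

lemma IsGPSet.false_of_walks (hS : IsGPSet H S) (hu : u ∈ S) (hv : v ∈ S) (hw : w ∈ S)
    (hwu : w ≠ u) (hwv : w ≠ v) (p : H.Walk u w) (q : H.Walk w v)
    (h : ∀ r : H.Walk u v, p.length + q.length ≤ r.length) : False := by
  have hd : (p.append q).length = H.dist u v := by
    apply le_antisymm _ (dist_le _)
    obtain ⟨r, hr⟩ := (p.append q).reachable.exists_walk_length_eq_dist
    rw [← hr, Walk.length_append]
    exact h r
  have := hS u hu v hv _ hd w hw (by simp [Walk.mem_support_append_iff])
  tauto

lemma IsGPSet.adj_of_adj_of_adj (hS : IsGPSet H S) (hu : u ∈ S) (hv : v ∈ S) (hw : w ∈ S)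
    (huw : H.Adj u w) (hwv : H.Adj w v) (huv : u ≠ v) : H.Adj u v := by
  by_contra hn
  refine hS.false_of_walks hu hv hw huw.ne' hwv.ne (.cons huw .nil) (.cons hwv .nil) fun r => ?_
  rcases r with _ | ⟨h, _ | _⟩
  · exact absurd rfl huv
  · exact absurd h hn
  · simp

lemma IsGPSet.exists_common_neighbor (hS : IsGPSet H S) (hu : u ∈ S) (hv : v ∈ S) (hw : w ∈ S)
    (hwu : w ≠ u) (huv : u ≠ v) (hn : ¬ H.Adj u v) {y : W} (huy : H.Adj u y) (hyw : H.Adj y w)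
    (hwv : H.Adj w v) : ∃ z, H.Adj u z ∧ H.Adj z v := by
  by_contra! hc
  refine hS.false_of_walks hu hv hw hwu hwv.ne (.cons huy (.cons hyw .nil)) (.cons hwv .nil)
    fun r => ?_
  rcases r with _ | ⟨h, _ | ⟨h', _ | _⟩⟩
  · exact absurd rfl huv
  · exact absurd h hn
  · exact absurd h' (hc _ h)
  · simp

lemma isGPSet_of_adj_or_common_neighbor
    (hd : ∀ u ∈ S, ∀ v ∈ S, u ≠ v → H.Adj u v ∨ ∃ w, H.Adj u w ∧ H.Adj w v)
    (h1 : ∀ u ∈ S, ∀ v ∈ S, ∀ w ∈ S, H.Adj w u → H.Adj w v → u = v) : IsGPSet H S := by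
  intro u hu v hv p hp w hw hwp
  match p, hp with
  | .nil, _ => simpa using hwp
  | .cons h .nil, _ => simpa using hwp
  | .cons (v := y) h (.cons h' .nil), hp =>
    simp only [Walk.support_cons, Walk.support_nil, List.mem_cons, List.not_mem_nil] at hwp
    rcases hwp with rfl | rfl | rfl | h
    · simp
    · have := h1 u hu v hv w hw h.symm h'
      subst this
      simp at hp
    · simp
    · simp at h
  | .cons (v := y) h (.cons h' (.cons h'' q)), hp =>
    exfalso
    by_cases huv : u = v
    · subst huv
      simp at hp
    rcases hd u hu v hv huv with h | ⟨z, h, h'⟩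
    · have := dist_le (Walk.cons h .nil)
      simp only [Walk.length_cons, Walk.length_nil] at this hp
      omega
    · have := dist_le (Walk.cons h (.cons h' .nil))
      simp only [Walk.length_cons, Walk.length_nil] at this hp
      omega

end GeneralPosition

section Numbers

variable {G : SimpleGraph V}

lemma exists_isGPSet_ncard_eq_gpNumber [Fintype V] (G : SimpleGraph V) :
    ∃ S, IsGPSet G S ∧ S.ncard = gpNumber G := by
  refine Nat.sSup_mem (s := {k | ∃ S : Set V, IsGPSet G S ∧ S.ncard = k}) ?_ ?_
  · exact ⟨0, ∅, by simp [IsGPSet], by simp⟩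
  · refine ⟨Fintype.card V, ?_⟩
    rintro k ⟨S, -, rfl⟩
    rw [← Nat.card_eq_fintype_card]
    exact Set.ncard_le_card S

lemma IsGPSet.ncard_le_gpNumber [Fintype V] {S : Set V} (hS : IsGPSet G S) :
    S.ncard ≤ gpNumber G := by
  refine le_csSup ?_ ⟨S, hS, rfl⟩
  refine ⟨Fintype.card V, ?_⟩
  rintro k ⟨S, -, rfl⟩
  rw [← Nat.card_eq_fintype_card]
  exact Set.ncard_le_card S

lemma ncard_le_indepNumber [Fintype V] {I : Set V} (hI : ∀ u ∈ I, ∀ v ∈ I, ¬ G.Adj u v) :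
    I.ncard ≤ indepNumber G := by
  refine le_csSup ?_ ⟨I, hI, rfl⟩
  refine ⟨Fintype.card V, ?_⟩
  rintro k ⟨S, -, rfl⟩
  rw [← Nat.card_eq_fintype_card]
  exact Set.ncard_le_card S

lemma indepNumber_le [Fintype V] {k : ℕ}
    (h : ∀ I : Set V, (∀ u ∈ I, ∀ v ∈ I, ¬ G.Adj u v) → I.ncard ≤ k) : indepNumber G ≤ k := by
  refine csSup_le ⟨0, ∅, by simp, by simp⟩ ?_
  rintro _ ⟨I, hI, rfl⟩
  exact h I hI

lemma two_le_indepNumber [Fintype V] {u v : V} (huv : u ≠ v) (h : ¬ G.Adj u v) :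
    2 ≤ indepNumber G := by
  have := ncard_le_indepNumber (G := G) (I := {u, v}) (by
    have := G.adj_comm u v
    simp; tauto)
  rwa [Set.ncard_pair huv] at this

lemma ncard_option_sum [Fintype V] (S : Set (Option (V ⊕ V))) :
    S.ncard = {v | some (Sum.inl v) ∈ S}.ncard + {v | some (Sum.inr v) ∈ S}.ncard +
      (S ∩ {none}).ncard := by
  have hl : Function.Injective fun v : V => (some (Sum.inl v) : Option (V ⊕ V)) :=
    fun a b h => by simpa using h
  have hr : Function.Injective fun v : V => (some (Sum.inr v) : Option (V ⊕ V)) :=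
    fun a b h => by simpa using h
  rw [← Set.ncard_image_of_injective _ hl, ← Set.ncard_image_of_injective _ hr,
    ← Set.ncard_union_eq, ← Set.ncard_union_eq]
  · congr 1
    ext (_ | z | z) <;> simp
  · rw [Set.disjoint_left]
    rintro _ (⟨a, -, rfl⟩ | ⟨a, -, rfl⟩) <;> simp
  · rw [Set.disjoint_left]
    rintro _ ⟨a, -, rfl⟩
    simp

end Numbers

section LowerBound

variable {G : SimpleGraph V}

/-- A set of original vertices and twins, as a set of vertices of the Mycielskian. -/
def originalsAndTwins (A B : Set V) : Set (Option (V ⊕ V)) :=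
  {z | (∃ v ∈ A, z = some (Sum.inl v)) ∨ ∃ v ∈ B, z = some (Sum.inr v)}

lemma ncard_originalsAndTwins [Fintype V] (A B : Set V) :
    (originalsAndTwins A B).ncard = A.ncard + B.ncard := by
  rw [ncard_option_sum]
  have : originalsAndTwins A B ∩ {none} = ∅ := by
    ext z
    simp only [originalsAndTwins, Set.mem_inter_iff, Set.mem_ofPred_eq, Set.mem_singleton_iff,
      Set.mem_empty_iff_false, iff_false]
    rintro ⟨⟨_, _, rfl⟩ | ⟨_, _, rfl⟩, h⟩ <;> simp at h
  rw [this]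
  simp [originalsAndTwins]

lemma isGPSet_originalsAndTwins {A B : Set V}
    (hind : ∀ u ∈ A, ∀ v ∈ A, ¬ G.Adj u v)
    (hAA : ∀ u ∈ A, ∀ v ∈ A, u ≠ v → ∃ w, G.Adj u w ∧ G.Adj w v)
    (hself : ∀ u ∈ A, ∃ w, G.Adj u w)
    (hAB : ∀ u ∈ A, ∀ v ∈ B, u ≠ v → G.Adj u v ∨ ∃ w, G.Adj u w ∧ G.Adj w v)
    (hA : ∀ u ∈ A, ∀ v ∈ B, ∀ w ∈ B, G.Adj u v → G.Adj u w → v = w)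
    (hB : ∀ u ∈ B, ∀ v ∈ A, ∀ w ∈ A, G.Adj u v → G.Adj u w → v = w) :
    IsGPSet (Mycielskian G) (originalsAndTwins A B) := by
  have key : ∀ u ∈ A, ∀ v ∈ B,
      G.Adj u v ∨ ∃ w, (Mycielskian G).Adj (some (Sum.inl u)) w ∧
        (Mycielskian G).Adj w (some (Sum.inr v)) := by
    intro u hu v hv
    by_cases huv : u = v
    · subst huv
      obtain ⟨w, hw⟩ := hself u hu
      exact Or.inr ⟨some (Sum.inl w), by simpa using hw, by simpa using hw.symm⟩
    · rcases hAB u hu v hv huv with h | ⟨w, h, h'⟩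
      · exact Or.inl h
      · exact Or.inr ⟨some (Sum.inl w), by simpa using h, by simpa using h'⟩
  apply isGPSet_of_adj_or_common_neighbor
  · rintro _ (⟨u, hu, rfl⟩ | ⟨u, hu, rfl⟩) _ (⟨v, hv, rfl⟩ | ⟨v, hv, rfl⟩) huv
    · obtain ⟨w, h, h'⟩ := hAA u hu v hv (by simpa using huv)
      exact Or.inr ⟨some (Sum.inl w), by simpa using h, by simpa using h'⟩
    · simpa using key u hu v hv
    · rcases key v hv u hu with h | ⟨w, h, h'⟩
      · exact Or.inl (by simpa using h.symm)
      · exact Or.inr ⟨w, h'.symm, h.symm⟩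
    · exact Or.inr ⟨none, by simp, by simp⟩
  · rintro _ (⟨u, hu, rfl⟩ | ⟨u, hu, rfl⟩) _ (⟨v, hv, rfl⟩ | ⟨v, hv, rfl⟩)
      _ (⟨w, hw, rfl⟩ | ⟨w, hw, rfl⟩) h h' <;> simp at h h'
    · exact absurd h (hind _ hw _ hu)
    · rw [hB w hw u hu v hv h h']
    · exact absurd h (hind _ hw _ hu)
    · exact absurd h' (hind _ hw _ hv)
    · rw [hA w hw u hu v hv h h']

lemma exists_gpSet_of_pendant_clique [Fintype V] {u : V} (hu : ∃! v, G.Adj u v)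
    (hK : G.IsClique {v | v ≠ u}) : ∃ S, IsGPSet (Mycielskian G) S ∧
      Fintype.card V + indepNumber G ≤ S.ncard + 1 := by
  obtain ⟨b, hb, hb'⟩ := hu
  refine ⟨originalsAndTwins {u} Set.univ, isGPSet_originalsAndTwins ?_ ?_ ?_ ?_ ?_ ?_, ?_⟩
  · simp
  · simp
  · rintro _ rfl
    exact ⟨b, hb⟩
  · rintro _ rfl v - huv
    by_cases hbv : b = v
    · exact Or.inl (hbv ▸ hb)
    · exact Or.inr ⟨b, hb, hK hb.ne' huv.symm hbv⟩
  · rintro _ rfl v - w - h h'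
    rw [hb' v h, hb' w h']
  · simp
  · rw [ncard_originalsAndTwins, Set.ncard_singleton, Set.ncard_univ, Nat.card_eq_fintype_card]
    have : indepNumber G ≤ 2 := by
      refine indepNumber_le fun I hI => ?_
      have h1 : (I \ {u}).ncard ≤ 1 := by
        rw [Set.ncard_le_one]
        rintro a ⟨ha, hau⟩ c ⟨hc, hcu⟩
        by_contra hac
        exact hI a ha c hc (hK hau hcu hac)
      have h2 := Set.ncard_le_ncard_sdiff_add_ncard I {u}
      simp only [Set.ncard_singleton] at h2
      omega
    omega

lemma exists_gpSet_of_star [Fintype V] (hiso : ∀ v : V, ∃ u, G.Adj v u) {c : V}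
    (hc : ∀ u v, G.Adj u v ↔ ((u = c ∨ v = c) ∧ u ≠ v)) : ∃ S, IsGPSet (Mycielskian G) S ∧
      Fintype.card V + indepNumber G ≤ S.ncard + 1 := by
  have hcard : ({c}ᶜ : Set V).ncard + 1 = Fintype.card V := by
    have := Set.ncard_add_ncard_compl ({c} : Set V)
    rw [Set.ncard_singleton, Nat.card_eq_fintype_card] at this
    omega
  refine ⟨originalsAndTwins {c}ᶜ {c}ᶜ, isGPSet_originalsAndTwins ?_ ?_ ?_ ?_ ?_ ?_, ?_⟩
  · simp only [Set.mem_compl_iff, Set.mem_singleton_iff, hc]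
    grind
  · intro u hu v hv _
    exact ⟨c, (hc _ _).2 ⟨by simp, hu⟩, (hc _ _).2 ⟨by simp, Ne.symm hv⟩⟩
  · exact fun u _ => hiso u
  · intro u hu v hv _
    exact Or.inr ⟨c, (hc _ _).2 ⟨by simp, hu⟩, (hc _ _).2 ⟨by simp, Ne.symm hv⟩⟩
  · simp only [Set.mem_compl_iff, Set.mem_singleton_iff, hc]
    grind
  · simp only [Set.mem_compl_iff, Set.mem_singleton_iff, hc]
    grind
  · rw [ncard_originalsAndTwins]
    have : indepNumber G + 1 ≤ Fintype.card V := by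
      rw [← hcard]
      refine Nat.succ_le_succ (indepNumber_le fun I hI => ?_)
      by_cases hcI : c ∈ I
      · have hsub : I ⊆ {c} := by
          intro a ha
          by_contra hac
          exact hI a ha c hcI ((hc _ _).2 ⟨by simp, hac⟩)
        obtain ⟨d, hd⟩ := hiso c
        have h1 := Set.ncard_le_ncard hsub
        have h2 := Set.ncard_le_ncard (s := {d}) (t := ({c}ᶜ : Set V)) (by simpa using hd.ne)
        simp only [Set.ncard_singleton] at h1 h2
        omega
      · exact Set.ncard_le_ncard (by simpa using hcI)
    omega

lemma exists_gpSet_of_partition [Fintype V] (hne : G ≠ ⊤) (hiso : ∀ v : V, ∃ u, G.Adj v u)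
    {V11 V12 V2 : Set V} {x : V}
    (huniv : insert x (V11 ∪ V12 ∪ V2) = Set.univ)
    (hx : x ∉ V11 ∪ V12 ∪ V2)
    (hdisj : List.Pairwise Disjoint [V11, V12, V2])
    (hind : ∀ u ∈ V11 ∪ V12, ∀ v ∈ V11 ∪ V12, ¬ G.Adj u v)
    (hleaf : ∀ u ∈ V11, G.Adj u x ∧ ∀ v, G.Adj u v → v = x)
    (hx12 : ∀ u ∈ V12, G.Adj x u)
    (hm : ∀ u ∈ V12, ∃! v, v ∈ V2 ∧ G.Adj u v)
    (hm' : ∀ v ∈ V2, ∃! u, u ∈ V12 ∧ G.Adj u v)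
    (hV2 : V2.Nonempty)
    (h1 : V11.Nonempty → ∀ v, v ≠ x → G.Adj x v)
    (h2 : V11 = ∅ → ∀ w ∈ V2, (∃ w' ∈ V2, w' ≠ w ∧ ¬ G.Adj w w') → G.Adj x w) :
    ∃ S, IsGPSet (Mycielskian G) S ∧ Fintype.card V + indepNumber G ≤ S.ncard + 1 := by
  have hcover : ∀ v, v = x ∨ v ∈ V11 ∨ v ∈ V12 ∨ v ∈ V2 := by
    intro v
    have : v ∈ insert x (V11 ∪ V12 ∪ V2) := huniv ▸ Set.mem_univ v
    simpa [or_assoc] using this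
  simp only [Set.mem_union, not_or] at hx
  simp only [List.pairwise_cons, List.mem_cons, List.not_mem_nil, or_false, forall_eq_or_imp,
    forall_eq, false_imp_iff, implies_true, List.Pairwise.nil, and_true,
    Set.disjoint_left] at hdisj
  obtain ⟨⟨hd1, hd2⟩, hd3⟩ := hdisj
  have hxC : ∀ u ∈ V11 ∪ V12, G.Adj x u := by
    rintro u (hu | hu)
    · exact (hleaf u hu).1.symm
    · exact hx12 u hu
  have hcard : ({x}ᶜ : Set V).ncard + 1 = Fintype.card V := by
    have := Set.ncard_add_ncard_compl ({x} : Set V)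
    rw [Set.ncard_singleton, Nat.card_eq_fintype_card] at this
    omega
  by_cases hsmall : V11 = ∅ ∧ V12.ncard ≤ 1
  · obtain ⟨h11, h12⟩ := hsmall
    obtain ⟨b, hb⟩ := hV2
    obtain ⟨c, ⟨hc, hcb⟩, -⟩ := hm' b hb
    rw [Set.ncard_le_one] at h12
    have hall : ∀ v, v = x ∨ v = c ∨ v = b := by
      intro v
      rcases hcover v with h | h | h | h
      · exact Or.inl h
      · simp [h11] at h
      · exact Or.inr (Or.inl (h12 v h c hc))
      · obtain ⟨d, ⟨hd, hdv⟩, -⟩ := hm' v h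
        obtain rfl := h12 d hd c hc
        exact Or.inr (Or.inr ((hm d hd).unique ⟨h, hdv⟩ ⟨hb, hcb⟩))
    have hxc := hx12 c hc
    have hxb : ¬ G.Adj x b := by
      intro hxb
      apply hne
      ext u v
      rw [top_adj]
      refine ⟨fun h => h.ne, fun h => ?_⟩
      rcases hall u with rfl | rfl | rfl <;> rcases hall v with rfl | rfl | rfl <;>
        first | exact absurd rfl h | assumption | (apply Adj.symm; assumption)
    have hxb' : ¬ G.Adj b x := fun h => hxb h.symm
    refine exists_gpSet_of_star hiso (c := c) fun u v => ?_
    refine ⟨fun h => ⟨?_, h.ne⟩, fun h => ?_⟩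
    · rcases hall u with rfl | rfl | rfl <;> rcases hall v with rfl | rfl | rfl <;> simp_all
    · have := hxc.symm
      have := hcb.symm
      rcases hall u with rfl | rfl | rfl <;> rcases hall v with rfl | rfl | rfl <;> grind
  refine ⟨originalsAndTwins (V11 ∪ V12) {x}ᶜ, isGPSet_originalsAndTwins hind ?_ ?_ ?_ ?_ ?_, ?_⟩
  · exact fun u hu v hv _ => ⟨x, (hxC u hu).symm, hxC v hv⟩
  · exact fun u _ => hiso u
  · intro u hu v hv huv
    by_cases hxv : G.Adj x v
    · exact Or.inr ⟨x, (hxC u hu).symm, hxv⟩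
    have h11 : V11 = ∅ := by
      rw [← Set.not_nonempty_iff_eq_empty]
      exact fun h => hxv (h1 h v hv)
    have hv2 : v ∈ V2 := by
      rcases hcover v with h | h | h | h
      · exact absurd h hv
      · exact absurd (hxC v (Or.inl h)) hxv
      · exact absurd (hxC v (Or.inr h)) hxv
      · exact h
    have hu12 : u ∈ V12 := by simpa [h11] using hu
    obtain ⟨w, ⟨hw, huw⟩, -⟩ := hm u hu12
    by_cases hwv : w = v
    · exact Or.inl (hwv ▸ huw)
    · refine Or.inr ⟨w, huw, ?_⟩
      by_contra hn
      exact hxv (h2 h11 v hv2 ⟨w, hw, hwv, fun h => hn h.symm⟩)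
  · intro u hu v hv w hw huv huw
    rcases hu with hu | hu
    · exact absurd ((hleaf u hu).2 v huv) hv
    · have aux : ∀ z, z ∈ ({x}ᶜ : Set V) → G.Adj u z → z ∈ V2 := by
        intro z hz huz
        have := hind u (Or.inr hu) z
        rcases hcover z with h | h | h | h
        · exact absurd h hz
        · exact absurd huz (this (Or.inl h))
        · exact absurd huz (this (Or.inr h))
        · exact h
      exact (hm u hu).unique ⟨aux v hv huv, huv⟩ ⟨aux w hw huw, huw⟩
  · intro u hu v hv w hw huv huw
    have aux : ∀ z ∈ V11 ∪ V12, G.Adj u z → z ∈ V12 := by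
      rintro z (hz | hz) huz
      · exact absurd ((hleaf z hz).2 u huz.symm) hu
      · exact hz
    have hu2 : u ∈ V2 := by
      rcases hcover u with h | h | h | h
      · exact absurd h hu
      · exact absurd huv (hind u (Or.inl h) v hv)
      · exact absurd huv (hind u (Or.inr h) v hv)
      · exact h
    exact (hm' u hu2).unique ⟨aux v hv huv, huv.symm⟩ ⟨aux w hw huw, huw.symm⟩
  · rw [ncard_originalsAndTwins]
    have : indepNumber G ≤ (V11 ∪ V12).ncard := by
      refine indepNumber_le fun I hI => ?_
      by_cases hxI : x ∈ I
      · by_cases h11 : V11 = ∅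
        · have hlt : 2 ≤ V12.ncard := by
            by_contra h
            exact hsmall ⟨h11, by omega⟩
          have hle : (I \ {x}).ncard ≤ 1 := by
            rw [Set.ncard_le_one]
            have aux : ∀ a ∈ I \ {x}, a ∈ V2 := by
              rintro a ⟨ha, hax⟩
              rcases hcover a with h | h | h | h
              · exact absurd h hax
              · exact absurd (hxC a (Or.inl h)) (hI x hxI a ha)
              · exact absurd (hxC a (Or.inr h)) (hI x hxI a ha)
              · exact h
            intro a ha c hc
            by_contra hac
            exact hI x hxI a ha.1
              (h2 h11 a (aux a ha) ⟨c, aux c hc, Ne.symm hac, hI a ha.1 c hc.1⟩)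
          have h2 := Set.ncard_le_ncard_sdiff_add_ncard I {x}
          simp only [Set.ncard_singleton] at h2
          rw [h11, Set.empty_union]
          omega
        · rw [← ne_eq, ← Set.nonempty_iff_ne_empty] at h11
          have hsub : I ⊆ {x} := by
            intro a ha
            by_contra hax
            exact hI x hxI a ha (h1 h11 a hax)
          have h3 := Set.ncard_le_ncard hsub
          have h4 : 0 < (V11 ∪ V12).ncard := (Set.ncard_pos).2 (h11.mono Set.subset_union_left)
          simp only [Set.ncard_singleton] at h3
          omega
      · choose! m hmm _ using hm'
        classical
        refine Set.ncard_le_ncard_of_injOn (fun v => if v ∈ V2 then m v else v) ?_ ?_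
        · intro a ha
          by_cases h : a ∈ V2
          · simp only [h, if_true]
            exact Or.inr (hmm a h).1
          · simp only [h, if_false]
            rcases hcover a with h' | h' | h' | h'
            · exact absurd (h' ▸ ha) hxI
            · exact Or.inl h'
            · exact Or.inr h'
            · exact absurd h' h
        · intro a ha c hc hac
          by_cases h : a ∈ V2 <;> by_cases h' : c ∈ V2 <;> simp only [h, h', if_true, if_false] at hac
          · have := hmm a h
            exact (hm (m a) this.1).unique ⟨h, this.2⟩ ⟨h', hac ▸ (hmm c h').2⟩
          · exact absurd (hac ▸ (hmm a h).2).symm (hI a ha c hc)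
          · exact absurd (hac ▸ (hmm c h').2) (hI a ha c hc)
          · exact hac
    omega

end LowerBound

section UpperBound

variable {G : SimpleGraph V} {S : Set (Option (V ⊕ V))}

/-- If `c` is a leaf at `b`, then the twin of `b` lies on a shortest path from `c` to any other
original vertex. -/
lemma IsGPSet.false_of_leaf (hS : IsGPSet (Mycielskian G) S) {a b c : V}
    (hiso : ∀ v : V, ∃ u, G.Adj v u)
    (hc : some (Sum.inl c) ∈ S) (hb : some (Sum.inr b) ∈ S) (ha : some (Sum.inl a) ∈ S)
    (hcb : G.Adj c b) (hleaf : ∀ v, G.Adj c v → v = b) (hac : a ≠ c) (hab : a ≠ b) : False := by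
  obtain ⟨l, hl⟩ := hiso a
  let p : (Mycielskian G).Walk (some (Sum.inr b)) (some (Sum.inl a)) :=
    .cons (v := none) (by simp) (.cons (v := some (Sum.inr l)) (by simp)
      (.cons (by simpa using hl.symm) .nil))
  obtain ⟨q, hq⟩ := p.reachable.exists_walk_length_eq_dist
  refine hS.false_of_walks hc ha hb (by simp) (by simp)
    (.cons (by simpa using hcb) .nil) q fun r => ?_
  cases r with
  | nil => exact absurd rfl hac
  | @cons _ y _ h r =>
    suffices q.length ≤ r.length by
      simp only [Walk.length_cons, Walk.length_nil]
      omega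
    rw [hq]
    rcases y with _ | y | y
    · simp at h
    · obtain rfl := hleaf y (by simpa using h)
      obtain ⟨q', hq'⟩ := exists_walk_from_twin hab r
      exact (dist_le q').trans hq'
    · obtain rfl := hleaf y (by simpa using h)
      exact dist_le r

lemma isClique_of_indepNumber_le_two [Fintype V] {b c : V} (hα : indepNumber G ≤ 2)
    (hleaf : ∀ v, G.Adj b v → v = c) (hck : ∀ k, k ≠ b → k ≠ c → G.Adj c k) :
    G.IsClique {v | v ≠ b} := by
  intro u hu v hv huv
  simp only [Set.mem_ofPred_eq] at hu hv
  by_cases huc : u = c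
  · subst huc
    exact hck v hv huv.symm
  by_cases hvc : v = c
  · subst hvc
    exact (hck u hu huc).symm
  by_contra hn
  have hbu : ¬ G.Adj b u := fun h => huc (hleaf u h)
  have hbv : ¬ G.Adj b v := fun h => hvc (hleaf v h)
  have h3 := ncard_le_indepNumber (G := G) (I := {b, u, v}) (by
    have := G.adj_comm b u
    have := G.adj_comm b v
    have := G.adj_comm u v
    simp
    tauto)
  rw [Set.ncard_eq_three.2 ⟨b, u, v, Ne.symm hu, Ne.symm hv, huv, rfl⟩] at h3
  omega

lemma eq_compl_singleton_of_ncard [Fintype V] {A : Set V} {c : V} (hc : c ∉ A)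
    (h : Fintype.card V ≤ A.ncard + 1) : A = {c}ᶜ ∧ A.ncard + 1 = Fintype.card V := by
  have hcard : ({c}ᶜ : Set V).ncard + 1 = Fintype.card V := by
    have := Set.ncard_add_ncard_compl ({c} : Set V)
    rw [Set.ncard_singleton, Nat.card_eq_fintype_card] at this
    omega
  have : A = {c}ᶜ := Set.eq_of_subset_of_ncard_le (by simpa using hc) (by omega)
  exact ⟨this, this ▸ hcard⟩

lemma IsGPSet.pendant_clique_of_root_mem [Fintype V] (hne : G ≠ ⊤)
    (hiso : ∀ v : V, ∃ u, G.Adj v u) (hS : IsGPSet (Mycielskian G) S) (hroot : none ∈ S)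
    (hα : 2 ≤ indepNumber G) (hcard : Fintype.card V + indepNumber G ≤ S.ncard + 1) :
    S.ncard + 1 = Fintype.card V + indepNumber G ∧
      ∃ u : V, (∃! v, G.Adj u v) ∧ G.IsClique {v | v ≠ u} := by
  have hsum := ncard_option_sum S
  rw [Set.inter_eq_right.2 (by simpa using hroot), Set.ncard_singleton] at hsum
  set A := {v | some (Sum.inl v) ∈ S} with hA
  set B := {v | some (Sum.inr v) ∈ S} with hB
  have hB1 : B.ncard ≤ 1 := by
    rw [Set.ncard_le_one]
    intro u hu v hv
    by_contra huv
    simpa using hS.adj_of_adj_of_adj hu hv hroot (by simp) (by simp) (by simpa using huv)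
  rcases B.eq_empty_or_nonempty with hBe | ⟨b, hb⟩
  · exfalso
    rw [hBe, Set.ncard_empty] at hsum
    have hAu : A = Set.univ := by
      apply Set.eq_of_subset_of_ncard_le (Set.subset_univ _)
      rw [Set.ncard_univ, Nat.card_eq_fintype_card]
      omega
    have hmem : ∀ v, some (Sum.inl v) ∈ S := fun v => by
      have : v ∈ A := hAu ▸ Set.mem_univ v
      exact this
    have htrans : ∀ a b c, G.Adj a b → G.Adj b c → a ≠ c → G.Adj a c := by
      intro a b c hab hbc hac
      simpa using hS.adj_of_adj_of_adj (hmem a) (hmem c) (hmem b) (by simpa using hab)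
        (by simpa using hbc) (by simpa using hac)
    obtain ⟨k, l, hkl, hn⟩ := ne_top_iff_exists_not_adj.1 hne
    obtain ⟨k', hk'⟩ := hiso k
    obtain ⟨l', hl'⟩ := hiso l
    refine hS.false_of_walks (hmem k) (hmem l) hroot (by simp) (by simp)
      (.cons (v := some (Sum.inr k')) (by simpa using hk') (.cons (by simp) .nil))
      (.cons (v := some (Sum.inr l')) (by simp) (.cons (by simpa using hl'.symm) .nil))
      fun r => ?_
    rcases r with _ | ⟨h, _ | ⟨h', _ | ⟨h'', _ | _⟩⟩⟩
    · exact absurd rfl hkl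
    · exact absurd (by simpa using h) hn
    · rename_i y
      rcases y with _ | y | y
      · simp at h
      all_goals
        simp at h h'
        exact absurd (htrans k y l h h' hkl) hn
    · rename_i y z
      have aux : ∀ y z, G.Adj k y → G.Adj y z → G.Adj z l → False := by
        intro y z h h' h''
        by_cases hkz : k = z
        · exact hn (hkz ▸ h'')
        · exact hn (htrans k z l (htrans k y z h h' hkz) h'' hkl)
      rcases y with _ | y | y
      · simp at h
      all_goals
        rcases z with _ | z | z
        · simp at h' h''
        all_goals
          simp at h h' h''
          try exact (aux y z h h' h'').elim
    · simp
  · have hbA : ∀ a, some (Sum.inl a) ∈ S → ¬ G.Adj b a := by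
      intro a ha hba
      simpa using hS.adj_of_adj_of_adj ha hroot hb (by simpa using hba.symm) (by simp) (by simp)
    obtain ⟨c, hbc⟩ := hiso b
    have hcA : c ∉ A := fun h => hbA c h hbc
    obtain ⟨hAc, hAn⟩ := eq_compl_singleton_of_ncard hcA (by omega)
    have hleaf : ∀ v, G.Adj b v → v = c := by
      intro v hv
      by_contra hvc
      have : v ∈ A := hAc ▸ hvc
      exact hbA v this hv
    refine ⟨by omega, b, ⟨c, hbc, hleaf⟩,
      isClique_of_indepNumber_le_two (by omega) hleaf fun k hkb hkc => ?_⟩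
    have hkA : k ∈ A := hAc ▸ hkc
    obtain ⟨l, hl⟩ := hiso k
    have hkb' : ¬ G.Adj k b := fun h => hkc (hleaf k h.symm)
    obtain ⟨z, hz, hz'⟩ := hS.exists_common_neighbor (y := some (Sum.inr l)) hkA hb hroot
      (by simp) (by simp) (by simpa using hkb') (by simpa using hl) (by simp) (by simp)
    rcases z with _ | z | z
    · simp at hz
    · simp only [mycielskian_adj_inl_inl, mycielskian_adj_inl_inr] at hz hz'
      rw [hleaf z hz'.symm] at hz
      exact hz.symm
    · simp at hz'

lemma IsGPSet.not_adj_of_twin_mem (hS : IsGPSet (Mycielskian G) S) {c v : V}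
    (hc : some (Sum.inl c) ∈ S) (hc' : some (Sum.inr c) ∈ S) (hv : some (Sum.inl v) ∈ S) :
    ¬ G.Adj c v := fun h => by
  simpa using hS.adj_of_adj_of_adj hc hc' hv (by simpa using h) (by simpa using h.symm) (by simp)

lemma IsGPSet.eq_of_adj_of_adj (hS : IsGPSet (Mycielskian G) S) {c v w : V}
    (hc : some (Sum.inl c) ∈ S) (hv : some (Sum.inr v) ∈ S) (hw : some (Sum.inr w) ∈ S)
    (hcv : G.Adj c v) (hcw : G.Adj c w) : v = w := by
  by_contra hvw
  simpa using hS.adj_of_adj_of_adj hv hw hc (by simpa using hcv.symm) (by simpa using hcw)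
    (by simpa using hvw)

lemma IsGPSet.pendant_clique_of_cover [Fintype V]
    (hiso : ∀ v : V, ∃ u, G.Adj v u) (hS : IsGPSet (Mycielskian G) S) (hroot : none ∉ S)
    (hα : 2 ≤ indepNumber G) (hcard : Fintype.card V + indepNumber G ≤ S.ncard + 1)
    (hcover : ∀ v, some (Sum.inl v) ∈ S ∨ some (Sum.inr v) ∈ S) :
    S.ncard + 1 = Fintype.card V + indepNumber G ∧
      ∃ u : V, (∃! v, G.Adj u v) ∧ G.IsClique {v | v ≠ u} := by
  have hsum := ncard_option_sum S
  rw [show S ∩ {none} = ∅ by simpa using hroot, Set.ncard_empty,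
    ← Set.ncard_union_add_ncard_inter,
    show {v | some (Sum.inl v) ∈ S} ∪ {v | some (Sum.inr v) ∈ S} = Set.univ from
      Set.eq_univ_of_forall hcover, Set.ncard_univ, Nat.card_eq_fintype_card] at hsum
  obtain ⟨c, hc, hc'⟩ := (Set.ncard_pos (s := {v | some (Sum.inl v) ∈ S} ∩
    {v | some (Sum.inr v) ∈ S})).1 (by omega)
  simp only [Set.mem_ofPred_eq] at hc hc'
  have hN : ∀ v, G.Adj c v → some (Sum.inr v) ∈ S := fun v h =>
    (hcover v).resolve_left fun hv => hS.not_adj_of_twin_mem hc hc' hv h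
  obtain ⟨b, hcb⟩ := hiso c
  have hb := hN b hcb
  have hleaf : ∀ v, G.Adj c v → v = b := fun v hv => hS.eq_of_adj_of_adj hc (hN v hv) hb hv hcb
  have hA : ∀ a, some (Sum.inl a) ∈ S → a = c := by
    intro a ha
    by_contra hac
    refine hS.false_of_leaf hiso hc hb ha hcb hleaf hac ?_
    rintro rfl
    exact hS.not_adj_of_twin_mem hc hc' ha hcb
  have hB : ∀ v, some (Sum.inr v) ∈ S := by
    intro v
    rcases hcover v with h | h
    · exact hA v h ▸ hc'
    · exact h
  have hC : ({v | some (Sum.inl v) ∈ S} ∩ {v | some (Sum.inr v) ∈ S}).ncard ≤ 1 := by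
    rw [Set.ncard_le_one]
    rintro u ⟨hu, -⟩ v ⟨hv, -⟩
    rw [hA u hu, hA v hv]
  refine ⟨by omega, c, ⟨b, hcb, hleaf⟩,
    isClique_of_indepNumber_le_two (by omega) hleaf fun k hkc hkb => ?_⟩
  have hkc' : ¬ G.Adj k c := fun h => hkb (hleaf k h.symm)
  obtain ⟨z, hz, hz'⟩ := hS.exists_common_neighbor (y := none) (hB k) hc hb
    (by simpa using Ne.symm hkb) (by simp) (by simpa using hkc') (by simp) (by simp)
    (by simpa using hcb.symm)
  rcases z with _ | z | z
  · simp at hz'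
  · simp only [mycielskian_adj_inl_inl, mycielskian_adj_inr_inl] at hz hz'
    rw [hleaf z hz'.symm] at hz
    exact hz.symm
  · simp at hz

lemma IsGPSet.star_or_partition_of_not_cover [Fintype V]
    (hiso : ∀ v : V, ∃ u, G.Adj v u) (hS : IsGPSet (Mycielskian G) S) (hroot : none ∉ S)
    (hα : 2 ≤ indepNumber G) (hcard : Fintype.card V + indepNumber G ≤ S.ncard + 1)
    {x : V} (hxA : some (Sum.inl x) ∉ S) (hxB : some (Sum.inr x) ∉ S) :
    S.ncard + 1 = Fintype.card V + indepNumber G ∧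
    ((∃ c : V, ∀ u v, G.Adj u v ↔ ((u = c ∨ v = c) ∧ u ≠ v)) ∨
     (∃ (V11 V12 V2 : Set V) (x : V),
        insert x (V11 ∪ V12 ∪ V2) = Set.univ ∧
        x ∉ V11 ∪ V12 ∪ V2 ∧
        List.Pairwise Disjoint [V11, V12, V2] ∧
        (∀ u ∈ V11 ∪ V12, ∀ v ∈ V11 ∪ V12, ¬ G.Adj u v) ∧
        (∀ u ∈ V11, G.Adj u x ∧ ∀ v, G.Adj u v → v = x) ∧
        (∀ u ∈ V12, G.Adj x u) ∧
        (∀ u ∈ V12, ∃! v, v ∈ V2 ∧ G.Adj u v) ∧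
        (∀ v ∈ V2, ∃! u, u ∈ V12 ∧ G.Adj u v) ∧
        V2.Nonempty ∧
        (V11.Nonempty → ∀ v, v ≠ x → G.Adj x v) ∧
        (V11 = ∅ → ∀ w ∈ V2, (∃ w' ∈ V2, w' ≠ w ∧ ¬ G.Adj w w') → G.Adj x w))) := by
  have hsum := ncard_option_sum S
  rw [show S ∩ {none} = ∅ by simpa using hroot, Set.ncard_empty,
    ← Set.ncard_union_add_ncard_inter] at hsum
  set A := {v | some (Sum.inl v) ∈ S} with hA
  set B := {v | some (Sum.inr v) ∈ S} with hB
  have hCind : ∀ u ∈ A ∩ B, ∀ v ∈ A ∩ B, ¬ G.Adj u v := fun u hu v hv =>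
    hS.not_adj_of_twin_mem hu.1 hu.2 hv.1
  have hCle := ncard_le_indepNumber hCind
  obtain ⟨hABx, hABn⟩ := eq_compl_singleton_of_ncard (A := A ∪ B) (c := x)
    (by rintro (h | h) <;> contradiction) (by omega)
  have hmax : ∀ a ∉ A ∩ B, ∃ c ∈ A ∩ B, G.Adj c a := by
    intro a ha
    by_contra! hn
    have := ncard_le_indepNumber (G := G) (I := insert a (A ∩ B)) (by
      have hn' : ∀ c ∈ A ∩ B, ¬ G.Adj a c := fun c hc h => hn c hc h.symm
      rintro u (rfl | hu) v (rfl | hv)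
      · simp
      · exact hn' v hv
      · exact hn u hu
      · exact hCind u hu v hv)
    rw [Set.ncard_insert_of_notMem ha] at this
    omega
  have hAB : A ⊆ B := by
    intro a ha
    by_contra haB
    obtain ⟨c, hc, hca⟩ := hmax a fun h => haB h.2
    exact hS.not_adj_of_twin_mem hc.1 hc.2 ha hca
  rw [Set.inter_eq_left.2 hAB] at hCind hmax hCle hsum
  rw [Set.union_eq_right.2 hAB] at hABx
  refine ⟨by omega, ?_⟩
  have hBmem : ∀ v, v ≠ x → some (Sum.inr v) ∈ S := by
    intro v hv
    have : v ∈ B := hABx ▸ hv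
    exact this
  have hxnA : x ∉ A := hxA
  have hone : ∀ c ∈ A, ∀ v w, v ≠ x → w ≠ x → G.Adj c v → G.Adj c w → v = w :=
    fun c hc v w hv hw => hS.eq_of_adj_of_adj hc (hBmem v hv) (hBmem w hw)
  by_cases hV2 : ∀ v, v ≠ x → v ∈ A
  · refine Or.inl ⟨x, fun u v => ⟨fun h => ⟨?_, h.ne⟩, ?_⟩⟩
    · by_contra! hn
      exact hCind u (hV2 u hn.1) v (hV2 v hn.2) h
    · have hxv : ∀ v, v ≠ x → G.Adj v x := by
        intro v hv
        obtain ⟨w, hw⟩ := hiso v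
        by_cases hwx : w = x
        · exact hwx ▸ hw
        · exact absurd hw (hCind v (hV2 v hv) w (hV2 w hwx))
      rintro ⟨rfl | rfl, h⟩
      · exact (hxv v h.symm).symm
      · exact hxv u h
  have hxC : ∀ c ∈ A, G.Adj c x := by
    intro c hc
    by_contra hcx
    obtain ⟨b, hcb⟩ := hiso c
    have hN : ∀ v, G.Adj c v → v ≠ x := by
      rintro v hv rfl
      exact hcx hv
    obtain ⟨a, ha, hac⟩ := Set.exists_ne_of_one_lt_ncard (s := A) (by omega) c
    refine hS.false_of_leaf hiso hc (hBmem b (hN b hcb)) ha hcb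
      (fun v hv => hone c hc v b (hN v hv) (hN b hcb) hv hcb) hac ?_
    rintro rfl
    exact hCind c hc a ha hcb
  refine Or.inr ⟨{a | a ∈ A ∧ ∀ v, G.Adj a v → v = x}, {a | a ∈ A ∧ ∃ v, v ≠ x ∧ G.Adj a v},
    {v | v ≠ x ∧ v ∉ A}, x, ?_, ?_, ?_, ?_, ?_, ?_, ?_, ?_, ?_, ?_, ?_⟩
  · apply Set.eq_univ_of_forall
    intro v
    simp only [Set.mem_insert_iff, Set.mem_union, Set.mem_ofPred_eq]
    grind
  · simp [hxnA]
  · simp only [List.pairwise_cons, List.mem_cons, List.not_mem_nil, or_false,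
      forall_eq_or_imp, forall_eq, false_imp_iff, implies_true, List.Pairwise.nil, and_true,
      Set.disjoint_left, Set.mem_ofPred_eq]
    grind
  · rintro u (hu | hu) v (hv | hv) <;> exact hCind u hu.1 v hv.1
  · exact fun u hu => ⟨hxC u hu.1, hu.2⟩
  · exact fun u hu => (hxC u hu.1).symm
  · rintro u ⟨hu, v, hvx, huv⟩
    exact ⟨v, ⟨⟨hvx, fun hv => hCind u hu v hv huv⟩, huv⟩,
      fun w hw => hone u hu w v hw.1.1 hvx hw.2 huv⟩
  · rintro v ⟨hvx, hvA⟩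
    obtain ⟨c, hc, hcv⟩ := hmax v hvA
    refine ⟨c, ⟨⟨hc, v, hvx, hcv⟩, hcv⟩, fun d hd => ?_⟩
    by_contra hdc
    refine hCind d hd.1.1 c hc ?_
    simpa using hS.adj_of_adj_of_adj hd.1.1 hc (hBmem v hvx) (by simpa using hd.2)
      (by simpa using hcv.symm) (by simpa using hdc)
  · push Not at hV2
    exact hV2
  · rintro ⟨d, hd, hdx⟩ v hvx
    by_cases hvA : v ∈ A
    · exact (hxC v hvA).symm
    obtain ⟨c, hc, hcv⟩ := hmax v hvA
    have hdv : ¬ G.Adj d v := fun h => hvx (hdx v h)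
    obtain ⟨z, hz, hz'⟩ := hS.exists_common_neighbor (y := some (Sum.inl x)) hd (hBmem v hvx) hc
      (by
        simp only [ne_eq, Option.some.injEq, Sum.inl.injEq]
        rintro rfl
        exact hdv hcv)
      (by simp) (by simpa using hdv) (by simpa using hxC d hd) (by simpa using (hxC c hc).symm)
      (by simpa using hcv)
    rcases z with _ | z | z
    · simp at hz
    · simp only [mycielskian_adj_inl_inl, mycielskian_adj_inl_inr] at hz hz'
      exact hdx z hz ▸ hz'
    · simp at hz'
  · rintro - w ⟨hwx, hwA⟩ ⟨w', ⟨hwx', hwA'⟩, hww', hn⟩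
    obtain ⟨c, hc, hcw⟩ := hmax w hwA
    obtain ⟨d, hd, hdw⟩ := hmax w' hwA'
    have hdw' : ¬ G.Adj d w := fun h => hww' (hone d hd w' w hwx' hwx hdw h)
    obtain ⟨z, hz, hz'⟩ := hS.exists_common_neighbor (y := some (Sum.inl x)) hd (hBmem w hwx) hc
      (by
        simp only [ne_eq, Option.some.injEq, Sum.inl.injEq]
        rintro rfl
        exact hdw' hcw)
      (by simp) (by simpa using hdw') (by simpa using hxC d hd) (by simpa using (hxC c hc).symm)
      (by simpa using hcw)
    rcases z with _ | z | z
    · simp at hz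
    · simp only [mycielskian_adj_inl_inl, mycielskian_adj_inl_inr] at hz hz'
      by_cases hzx : z = x
      · exact hzx ▸ hz'
      · rw [hone d hd z w' hzx hwx' hz hdw] at hz'
        exact absurd hz'.symm hn
    · simp at hz'

end UpperBound

lemma eq_iff_of_imp_le {a b : ℕ} {P : Prop} (hP : P → b ≤ a) (h : b ≤ a → a = b ∧ P) :
    a = b ↔ P :=
  ⟨fun hab => (h hab.ge).2, fun p => (h (hP p)).1⟩

/-- Characterisation of the non-complete graphs with no isolated vertices
satisfying `gp(μ(G)) = n + α(G) - 1`: a clique with one pendant leaf, a star, or the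
partition structure `(V11, V12, V2, {x})` described in the paper. -/
theorem gpNumber_mycielskian_eq_n_add_alpha_sub_one_iff [Fintype V] (G : SimpleGraph V)
    (hne : G ≠ ⊤) (hiso : ∀ v : V, ∃ u, G.Adj v u) :
    gpNumber (Mycielskian G) + 1 = Fintype.card V + indepNumber G ↔
    ((∃ u : V, (∃! v, G.Adj u v) ∧ G.IsClique {v | v ≠ u}) ∨
     (∃ c : V, ∀ u v, G.Adj u v ↔ ((u = c ∨ v = c) ∧ u ≠ v)) ∨
     (∃ (V11 V12 V2 : Set V) (x : V),
        insert x (V11 ∪ V12 ∪ V2) = Set.univ ∧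
        x ∉ V11 ∪ V12 ∪ V2 ∧
        List.Pairwise Disjoint [V11, V12, V2] ∧
        (∀ u ∈ V11 ∪ V12, ∀ v ∈ V11 ∪ V12, ¬ G.Adj u v) ∧
        (∀ u ∈ V11, G.Adj u x ∧ ∀ v, G.Adj u v → v = x) ∧
        (∀ u ∈ V12, G.Adj x u) ∧
        (∀ u ∈ V12, ∃! v, v ∈ V2 ∧ G.Adj u v) ∧
        (∀ v ∈ V2, ∃! u, u ∈ V12 ∧ G.Adj u v) ∧
        V2.Nonempty ∧
        (V11.Nonempty → ∀ v, v ≠ x → G.Adj x v) ∧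
        (V11 = ∅ → ∀ w ∈ V2, (∃ w' ∈ V2, w' ≠ w ∧ ¬ G.Adj w w') → G.Adj x w))) := by
  obtain ⟨k, l, hkl, hn⟩ := ne_top_iff_exists_not_adj.1 hne
  have hα := two_le_indepNumber hkl hn
  obtain ⟨T, hT, hTn⟩ := exists_isGPSet_ncard_eq_gpNumber (Mycielskian G)
  rw [← hTn]
  refine eq_iff_of_imp_le (fun h => ?_) fun h => ?_
  · obtain ⟨S, hS, hcard⟩ : ∃ S, IsGPSet (Mycielskian G) S ∧
        Fintype.card V + indepNumber G ≤ S.ncard + 1 := by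
      rcases h with ⟨u, hu, hK⟩ | ⟨c, hc⟩ |
        ⟨V11, V12, V2, x, h1, h2, h3, h4, h5, h6, h7, h8, h9, h10, h11⟩
      · exact exists_gpSet_of_pendant_clique hu hK
      · exact exists_gpSet_of_star hiso hc
      · exact exists_gpSet_of_partition hne hiso h1 h2 h3 h4 h5 h6 h7 h8 h9 h10 h11
    have := hS.ncard_le_gpNumber
    omega
  · by_cases hroot : none ∈ T
    · exact (hT.pendant_clique_of_root_mem hne hiso hroot hα h).imp_right Or.inl
    by_cases hcover : ∀ v, some (Sum.inl v) ∈ T ∨ some (Sum.inr v) ∈ T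
    · exact (hT.pendant_clique_of_cover hiso hroot hα h hcover).imp_right Or.inl
    push Not at hcover
    obtain ⟨x, hxA, hxB⟩ := hcover
    exact (hT.star_or_partition_of_not_cover hiso hroot hα h hxA hxB).imp_right Or.inr
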